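/- Let A be a C*-algebra and let π : A → B(H) and π' : A → B(K) be injective *-homomorphisms into the bounded operators on complex Hilbert spaces H and K, each acting nondegenerately (the linear span of {π(a) ξ : a ∈ A, ξ ∈ H} is dense in H, and the linear span of {π'(a) η : a ∈ A, η ∈ K} is dense in K). Let QM^π := {T ∈ B(H) : π(a)·T·π(b) ∈ π(A) for all a, b ∈ A} and QM^{π'} := {S ∈ B(K) : π'(a)·S·π'(b) ∈ π'(A) for all a, b ∈ A}. Then there exists an isometric linear bijection σ : QM^π → QM^{π'} that is a quasi-isomorphism: for all a, b, c ∈ A and T ∈ QM^π, if π(a)·T·π(b) = π(c) then π'(a)·σ(T)·π'(b) = π'(c). -/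

import Mathlib

open Filter Topology in
theorem exists_tendsto_inner_of_eventually_norm_le {ι K : Type*} [NormedAddCommGroup K]
    [InnerProductSpace ℂ K] [CompleteSpace K] (l : Ultrafilter ι) (F : ι → K →L[ℂ] K) {M : ℝ}
    (hF : ∀ᶠ i in (l : Filter ι), ‖F i‖ ≤ M) :
    ∃ S : K →L[ℂ] K, ‖S‖ ≤ M ∧
      ∀ ξ η, Tendsto (fun i ↦ inner ℂ (F i ξ) η) l (𝓝 (inner ℂ (S ξ) η)) := by
  have hM : 0 ≤ M := by
    obtain ⟨i, hi⟩ := hF.exists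
    exact (norm_nonneg _).trans hi
  have hlim (ξ η : K) : ∃ z : ℂ, ‖z‖ ≤ M * ‖ξ‖ * ‖η‖ ∧
      Tendsto (fun i ↦ inner ℂ (F i ξ) η) l (𝓝 z) := by
    have hmem : ∀ᶠ i in (l : Filter ι),
        inner ℂ (F i ξ) η ∈ Metric.closedBall (0 : ℂ) (M * ‖ξ‖ * ‖η‖) := by
      filter_upwards [hF] with i hi
      rw [mem_closedBall_zero_iff]
      refine (norm_inner_le_norm _ _).trans ?_
      gcongr
      exact (F i).le_of_opNorm_le hi ξ
    obtain ⟨z, hz, hlz⟩ := (isCompact_closedBall (0 : ℂ) (M * ‖ξ‖ * ‖η‖)).ultrafilter_le_nhds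
      (l.map fun i ↦ inner ℂ (F i ξ) η) (le_principal_iff.mpr hmem)
    exact ⟨z, mem_closedBall_zero_iff.mp hz, hlz⟩
  choose f hfM hf using hlim
  let B : K →ₗ⋆[ℂ] K →ₗ[ℂ] ℂ := LinearMap.mk₂'ₛₗ _ _ f
    (fun x y z ↦ tendsto_nhds_unique (hf _ _) <| by
      simpa only [map_add, inner_add_left] using! (hf x z).add (hf y z))
    (fun c x z ↦ tendsto_nhds_unique (hf _ _) <| by
      simpa only [map_smul, inner_smul_left] using! (hf x z).const_mul _)
    (fun x y z ↦ tendsto_nhds_unique (hf _ _) <| by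
      simpa only [inner_add_right] using! (hf x y).add (hf x z))
    (fun c x z ↦ tendsto_nhds_unique (hf _ _) <| by
      simpa only [inner_smul_right] using! (hf x z).const_mul _)
  let S := InnerProductSpace.continuousLinearMapOfBilin (B.mkContinuous₂ M hfM)
  have hS (ξ η : K) : inner ℂ (S ξ) η = f ξ η :=
    InnerProductSpace.continuousLinearMapOfBilin_apply _ ξ η
  refine ⟨S, S.opNorm_le_bound hM fun ξ ↦ ?_, fun ξ η ↦ hS ξ η ▸ hf ξ η⟩
  obtain h | h := (norm_nonneg (S ξ)).eq_or_lt
  · rw [← h]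
    positivity
  · refine le_of_mul_le_mul_right ?_ h
    rw [← inner_self_eq_norm_mul_norm (𝕜 := ℂ), hS]
    exact (Complex.re_le_norm _).trans (hfM ξ (S ξ))

theorem CStarAlgebra.exists_isApproximateUnit_norm_le_one (A : Type*) [NonUnitalCStarAlgebra A] :
    ∃ l : Filter A, l.IsApproximateUnit ∧ ∀ᶠ x in l, ‖x‖ ≤ 1 := by
  let _ := CStarAlgebra.spectralOrder A
  have _ := CStarAlgebra.spectralOrderedRing A
  have h := CStarAlgebra.increasingApproximateUnit A
  exact ⟨_, h.toIsApproximateUnit, h.eventually_norm⟩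

section QuasiMultiplier

variable {A : Type*} [NonUnitalCStarAlgebra A]
  {H K : Type*} [NormedAddCommGroup H] [InnerProductSpace ℂ H] [CompleteSpace H]
  [NormedAddCommGroup K] [InnerProductSpace ℂ K] [CompleteSpace K]

open Filter Topology in
theorem exists_quasiMultiplier_of_injective (π : A →⋆ₙₐ[ℂ] (H →L[ℂ] H))
    (π' : A →⋆ₙₐ[ℂ] (K →L[ℂ] K)) (hπ : Function.Injective π) (hπ' : Function.Injective π')
    {T : H →L[ℂ] H} (hT : ∀ a b : A, π a * T * π b ∈ Set.range π) :
    ∃ S : K →L[ℂ] K, ‖S‖ ≤ ‖T‖ ∧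
      ∀ a b c : A, π a * T * π b = π c → π' a * S * π' b = π' c := by
  choose q hq using hT
  obtain ⟨l₀, hl₀, hl₀_norm⟩ := CStarAlgebra.exists_isApproximateUnit_norm_le_one A
  have := hl₀.neBot
  let l : Ultrafilter A := .of l₀
  have hl_norm : ∀ᶠ e in (l : Filter A), ‖e‖ ≤ 1 := Ultrafilter.of_le l₀ hl₀_norm
  obtain ⟨S, hST, hS⟩ := exists_tendsto_inner_of_eventually_norm_le l (fun e ↦ π' (q e e))
    (M := ‖T‖) <| by
      filter_upwards [hl_norm] with e he
      rw [NonUnitalStarAlgHom.norm_map π' hπ', ← NonUnitalStarAlgHom.norm_map π hπ, hq]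
      have he' : ‖π e‖ ≤ 1 := (NonUnitalStarAlgHom.norm_map π hπ e).trans_le he
      calc ‖π e * T * π e‖ ≤ ‖π e‖ * ‖T‖ * ‖π e‖ := norm_mul₃_le
        _ ≤ 1 * ‖T‖ * 1 := by gcongr
        _ = ‖T‖ := by ring
  refine ⟨S, hST, fun a b c hc ↦ ?_⟩
  have hπi := NonUnitalStarAlgHom.isometry π hπ
  have hπi' := NonUnitalStarAlgHom.isometry π' hπ'
  have hlim : Tendsto (fun e ↦ a * q e e * b) l (𝓝 c) := by
    rw [hπi.isEmbedding.tendsto_nhds_iff, ← hc]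
    have h₁ := (hπi.continuous.tendsto a).comp
      ((hl₀.tendsto_mul_left a).mono_left (Ultrafilter.of_le l₀))
    have h₂ := (hπi.continuous.tendsto b).comp
      ((hl₀.tendsto_mul_right b).mono_left (Ultrafilter.of_le l₀))
    refine ((h₁.mul_const T).mul h₂).congr fun e ↦ ?_
    simp only [Function.comp_apply, map_mul, hq, mul_assoc]
  have hlim' := (hπi'.continuous.tendsto c).comp hlim
  ext1 ξ
  refine ext_inner_right ℂ fun η ↦ ?_
  refine tendsto_nhds_unique ?_ (((ContinuousLinearMap.apply ℂ K ξ).continuous.tendsto _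
    |>.comp hlim').inner tendsto_const_nhds)
  convert! hS (π' b ξ) (π' (star a) η) using 2
  · simp [map_star, ContinuousLinearMap.star_eq_adjoint, ContinuousLinearMap.adjoint_inner_right]
  · simp [map_star, ContinuousLinearMap.star_eq_adjoint, ContinuousLinearMap.adjoint_inner_right]

theorem eq_zero_of_forall_apply_eq_zero (π : A →⋆ₙₐ[ℂ] (H →L[ℂ] H))
    (hπ : Dense ((Submodule.span ℂ {ξ : H | ∃ a : A, ∃ η : H, π a η = ξ} :
      Submodule ℂ H) : Set H)) {v : H} (hv : ∀ a, π a v = 0) : v = 0 := by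
  refine hπ.eq_zero_of_mem_orthogonal (𝕜 := ℂ) ?_
  rw [Submodule.mem_orthogonal]
  intro u hu
  induction hu using Submodule.span_induction with
  | mem x hx =>
    obtain ⟨a, η, rfl⟩ := hx
    rw [← ContinuousLinearMap.adjoint_inner_right, ← ContinuousLinearMap.star_eq_adjoint,
      ← map_star, hv, inner_zero_right]
  | zero => simp
  | add x y _ _ hx hy => simp [inner_add_left, hx, hy]
  | smul c x _ hx => simp [inner_smul_left, hx]

theorem eq_of_forall_mul_mul_eq (π : A →⋆ₙₐ[ℂ] (H →L[ℂ] H))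
    (hπ : Dense ((Submodule.span ℂ {ξ : H | ∃ a : A, ∃ η : H, π a η = ξ} :
      Submodule ℂ H) : Set H)) {S T : H →L[ℂ] H}
    (h : ∀ a b, π a * S * π b = π a * T * π b) : S = T := by
  refine ContinuousLinearMap.ext_on hπ ?_
  rintro _ ⟨b, η, rfl⟩
  rw [← sub_eq_zero]
  refine eq_zero_of_forall_apply_eq_zero π hπ fun a ↦ ?_
  rw [map_sub, sub_eq_zero]
  exact DFunLike.congr_fun (h a b) η

end QuasiMultiplier


/-- Let `A` be a C*-algebra and `π : A → B(H)`, `π' : A → B(K)` injective nondegenerate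
*-representations.  Then the relative quasi-multiplier spaces
`QM^π = {T ∈ B(H) : π(A)·T·π(A) ⊆ π(A)}` and `QM^{π'}` are related by an isometric
linear bijection `σ` which is a quasi-isomorphism:
`π(a)·T·π(b) = π(c)` implies `π'(a)·σ(T)·π'(b) = π'(c)`. -/
theorem stmt9 {A : Type*} [NonUnitalCStarAlgebra A] [StarModule ℂ A]
    {H K : Type*} [NormedAddCommGroup H] [InnerProductSpace ℂ H] [CompleteSpace H]
    [NormedAddCommGroup K] [InnerProductSpace ℂ K] [CompleteSpace K]
    (π : A →⋆ₙₐ[ℂ] (H →L[ℂ] H)) (π' : A →⋆ₙₐ[ℂ] (K →L[ℂ] K))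
    (hπinj : Function.Injective π) (hπ'inj : Function.Injective π')
    (hπnd : Dense ((Submodule.span ℂ {ξ : H | ∃ a : A, ∃ η : H, π a η = ξ} :
      Submodule ℂ H) : Set H))
    (hπ'nd : Dense ((Submodule.span ℂ {ξ : K | ∃ a : A, ∃ η : K, π' a η = ξ} :
      Submodule ℂ K) : Set K)) :
    ∃ σ : {T : H →L[ℂ] H // ∀ a b : A, π a * T * π b ∈ Set.range π} →
          {S : K →L[ℂ] K // ∀ a b : A, π' a * S * π' b ∈ Set.range π'},
      Function.Bijective σ ∧
      -- `σ` is linear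
      (∀ (s : ℂ) (T T' T'' : {T : H →L[ℂ] H // ∀ a b : A, π a * T * π b ∈ Set.range π}),
        (T'' : H →L[ℂ] H) = s • (T : H →L[ℂ] H) + (T' : H →L[ℂ] H) →
        (σ T'' : K →L[ℂ] K) = s • (σ T : K →L[ℂ] K) + (σ T' : K →L[ℂ] K)) ∧
      -- `σ` is isometric
      (∀ T, ‖(σ T : K →L[ℂ] K)‖ = ‖(T : H →L[ℂ] H)‖) ∧
      -- `σ` is a quasi-isomorphism
      (∀ (a b c : A) (T : {T : H →L[ℂ] H // ∀ a b : A, π a * T * π b ∈ Set.range π}),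
        π a * (T : H →L[ℂ] H) * π b = π c → π' a * (σ T : K →L[ℂ] K) * π' b = π' c) := by
  have ex (T : {T : H →L[ℂ] H // ∀ a b : A, π a * T * π b ∈ Set.range π}) :
      ∃ S : {S : K →L[ℂ] K // ∀ a b : A, π' a * S * π' b ∈ Set.range π'},
        ‖(S : K →L[ℂ] K)‖ ≤ ‖(T : H →L[ℂ] H)‖ ∧
        ∀ a b c : A, π a * (T : H →L[ℂ] H) * π b = π c →
          π' a * (S : K →L[ℂ] K) * π' b = π' c := by
    obtain ⟨S, hS, h⟩ := exists_quasiMultiplier_of_injective π π' hπinj hπ'inj T.2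
    refine ⟨⟨S, fun a b ↦ ?_⟩, hS, h⟩
    obtain ⟨c, hc⟩ := T.2 a b
    exact ⟨c, (h a b c hc.symm).symm⟩
  have ex' (S : {S : K →L[ℂ] K // ∀ a b : A, π' a * S * π' b ∈ Set.range π'}) :
      ∃ T : {T : H →L[ℂ] H // ∀ a b : A, π a * T * π b ∈ Set.range π},
        ‖(T : H →L[ℂ] H)‖ ≤ ‖(S : K →L[ℂ] K)‖ ∧
        ∀ a b c : A, π' a * (S : K →L[ℂ] K) * π' b = π' c →
          π a * (T : H →L[ℂ] H) * π b = π c := by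
    obtain ⟨T, hT, h⟩ := exists_quasiMultiplier_of_injective π' π hπ'inj hπinj S.2
    refine ⟨⟨T, fun a b ↦ ?_⟩, hT, h⟩
    obtain ⟨c, hc⟩ := S.2 a b
    exact ⟨c, (h a b c hc.symm).symm⟩
  choose σ hσ_norm hσ using ex
  choose τ hτ_norm hτ using ex'
  have hτσ : Function.LeftInverse τ σ := fun T ↦ Subtype.ext <|
    eq_of_forall_mul_mul_eq π hπnd fun a b ↦ by
      obtain ⟨c, hc⟩ := T.2 a b
      rw [← hc, hτ _ a b c (hσ T a b c hc.symm)]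
  have hστ : Function.RightInverse τ σ := fun S ↦ Subtype.ext <|
    eq_of_forall_mul_mul_eq π' hπ'nd fun a b ↦ by
      obtain ⟨c, hc⟩ := S.2 a b
      rw [← hc, hσ _ a b c (hτ S a b c hc.symm)]
  refine ⟨σ, ⟨hτσ.injective, hστ.surjective⟩, fun s T T' T'' h ↦ ?_, fun T ↦ ?_,
    fun a b c T ↦ hσ T a b c⟩
  · refine eq_of_forall_mul_mul_eq π' hπ'nd fun a b ↦ ?_
    obtain ⟨c, hc⟩ := T.2 a b
    obtain ⟨c', hc'⟩ := T'.2 a b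
    have h'' : π a * (T'' : H →L[ℂ] H) * π b = π (s • c + c') := by
      rw [h, map_add, map_smul, hc, hc', mul_add, add_mul, mul_smul_comm, smul_mul_assoc]
    rw [hσ T'' a b _ h'', mul_add, add_mul, mul_smul_comm, smul_mul_assoc,
      hσ T a b c hc.symm, hσ T' a b c' hc'.symm, map_add, map_smul]
  · refine (hσ_norm T).antisymm ?_
    simpa only [hτσ T] using hτ_norm (σ T)
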